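/- Let $f\in L_p(\mathbb{T})$, $1\le p<\infty$, $\delta>0$, and $n\in\mathbb{N}$, and suppose the sampling operators $G_n$ satisfy condition (c2') with $s=1$ and condition (c1). Then $\|f-G_n(f)\|_p\le K_1\|f_\delta-f\|_{\ell_p(X_n)}+\big(1+\frac{K_3}{\delta n}\big)\,\omega_1(f,\delta)_p$. -/

import Mathlib

open MeasureTheory Filter Finset

noncomputable def LpNorm (p : ℝ) (f : ℝ → ℝ) : ℝ :=
  (∫ x in (0:ℝ)..1, |f x| ^ p) ^ (1 / p)

def MemLpT (p : ℝ) (f : ℝ → ℝ) : Prop :=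
  Function.Periodic f 1 ∧ Measurable f ∧
    IntervalIntegrable (fun x => |f x| ^ p) MeasureTheory.volume 0 1

noncomputable def Delta (r : ℕ) (h : ℝ) (f : ℝ → ℝ) (x : ℝ) : ℝ :=
  ∑ ν ∈ Finset.range (r + 1), ((-1 : ℝ) ^ ν * (r.choose ν : ℝ)) * f (x + ((r : ℝ) - (ν : ℝ)) * h)

noncomputable def omegaMod (r : ℕ) (p : ℝ) (f : ℝ → ℝ) (δ : ℝ) : ℝ :=
  sSup {y | ∃ h : ℝ, 0 < h ∧ h < δ ∧ y = LpNorm p (Delta r h f)}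

noncomputable def steklov (r : ℕ) (δ : ℝ) (f : ℝ → ℝ) (x : ℝ) : ℝ :=
  (-1 : ℝ) ^ (r + 1) * (((2 * r).choose r : ℝ))⁻¹ * (2 / δ) *
    ∫ t in (-(δ / 2))..(δ / 2),
      ∑ ν ∈ Finset.range r,
        (-1 : ℝ) ^ ν * (((2 * r).choose ν : ℝ)) * f (x + (((r : ℝ) - (ν : ℝ)) / (r : ℝ)) * t)

noncomputable def ellp (p : ℝ) (n : ℕ) (x : ℕ → ℝ) (f : ℝ → ℝ) : ℝ :=
  ((1 / (n : ℝ)) * ∑ k ∈ Finset.range n, |f (x k)| ^ p) ^ (1 / p)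

def SobolevW (s : ℕ) (g : ℝ → ℝ) : Prop :=
  Function.Periodic g 1 ∧ ContDiff ℝ (s : ℕ∞) g

noncomputable def localMod (r : ℕ) (f : ℝ → ℝ) (x δ : ℝ) : ℝ :=
  sSup {y | ∃ t h : ℝ, t ∈ Set.Icc (x - r * δ / 2) (x + r * δ / 2) ∧
    (t + r * h) ∈ Set.Icc (x - r * δ / 2) (x + r * δ / 2) ∧ y = |Delta r h f t|}

noncomputable def tauMod (r : ℕ) (p : ℝ) (f : ℝ → ℝ) (δ : ℝ) : ℝ :=
  (∫ x in (0:ℝ)..1, localMod r f x δ ^ p) ^ (1 / p)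

def IsTrigPoly (n : ℕ) (T : ℝ → ℝ) : Prop :=
  ∃ c : ℤ → ℂ, ∀ x : ℝ, (T x : ℂ) =
    ∑ ℓ ∈ Finset.Icc (-(n : ℤ)) (n : ℤ),
      c ℓ * Complex.exp (2 * Real.pi * Complex.I * (ℓ : ℂ) * (x : ℂ))

noncomputable def tildeE (n : ℕ) (p : ℝ) (f : ℝ → ℝ) : ℝ :=
  sInf {y | ∃ Q q : ℝ → ℝ, IsTrigPoly n Q ∧ IsTrigPoly n q ∧
    (∀ x, q x ≤ f x ∧ f x ≤ Q x) ∧ y = LpNorm p (fun x => Q x - q x)}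

noncomputable def dirichlet (n : ℕ) (x : ℝ) : ℝ :=
  ∑ ℓ ∈ Finset.Icc (-(n : ℤ)) (n : ℤ), Real.cos (2 * Real.pi * (ℓ : ℝ) * x)

noncomputable def lagrange (n : ℕ) (f : ℝ → ℝ) (x : ℝ) : ℝ :=
  (1 / (2 * (n : ℝ) + 1)) * ∑ k ∈ Finset.range (2 * n + 1),
    f ((k : ℝ) / (2 * (n : ℝ) + 1)) * dirichlet n (x - (k : ℝ) / (2 * (n : ℝ) + 1))

def NodesOK (γ : ℝ) (X : ℕ → ℕ → ℝ) : Prop :=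
  ∀ n : ℕ, 1 ≤ n →
    (0 ≤ X n 0) ∧ (∀ k, k + 1 < n → X n k < X n (k + 1)) ∧ (X n (n - 1) < 1) ∧
    (∀ k, k + 1 < n → γ / (n : ℝ) ≤ X n (k + 1) - X n k) ∧
    (γ / (n : ℝ) ≤ 1 + X n 0 - X n (n - 1))

def NodesOrd (X : ℕ → ℕ → ℝ) : Prop :=
  ∀ n : ℕ, 1 ≤ n →
    (0 ≤ X n 0) ∧ (∀ k, k + 1 < n → X n k < X n (k + 1)) ∧ (X n (n - 1) < 1)

def SamplingForm (p : ℝ) (X : ℕ → ℕ → ℝ) (φ : ℕ → ℕ → ℝ → ℝ)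
    (G : ℕ → (ℝ → ℝ) → ℝ → ℝ) : Prop :=
  (∀ n k, MemLpT p (φ n k)) ∧
  ∀ (n : ℕ) (f : ℝ → ℝ) (x : ℝ), G n f x = ∑ k ∈ Finset.range n, f (X n k) * φ n k x

def CondC1 (p K1 : ℝ) (X : ℕ → ℕ → ℝ) (G : ℕ → (ℝ → ℝ) → ℝ → ℝ) : Prop :=
  ∀ f : ℝ → ℝ, MemLpT p f → ∀ n : ℕ, 1 ≤ n → LpNorm p (G n f) ≤ K1 * ellp p n (X n) f

def CondC1' (p K2 : ℝ) (X : ℕ → ℕ → ℝ) (G : ℕ → (ℝ → ℝ) → ℝ → ℝ) : Prop :=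
  ∀ f : ℝ → ℝ, MemLpT p f → ∀ n : ℕ, 1 ≤ n → K2 * ellp p n (X n) f ≤ LpNorm p (G n f)

def CondC2' (p K3 : ℝ) (s : ℕ) (G : ℕ → (ℝ → ℝ) → ℝ → ℝ) : Prop :=
  ∀ g : ℝ → ℝ, SobolevW s g → ∀ n : ℕ, 1 ≤ n →
    LpNorm p (fun x => g x - G n g x) ≤ K3 / (n : ℝ) ^ s * LpNorm p (iteratedDeriv s g)

def CondC3 (p K5 : ℝ) (s : ℕ) (G : ℕ → (ℝ → ℝ) → ℝ → ℝ) : Prop :=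
  ∀ f : ℝ → ℝ, MemLpT p f → ∀ n : ℕ, 1 ≤ n →
    SobolevW s (G n f) ∧
    (1 / (n : ℝ) ^ s) * LpNorm p (iteratedDeriv s (G n f)) ≤
      K5 * omegaMod s p (G n f) (1 / (n : ℝ))

noncomputable def Gprev (G : ℕ → (ℝ → ℝ) → ℝ → ℝ) (f : ℝ → ℝ) (ν : ℕ) : ℝ → ℝ :=
  if ν = 0 then fun _ => 0 else G (2 ^ (ν - 1)) f

def CondC4 (p K4 : ℝ) (s : ℕ) (G : ℕ → (ℝ → ℝ) → ℝ → ℝ) (f : ℝ → ℝ) : Prop :=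
  ∀ ν : ℕ,
    SobolevW s (fun x => G (2 ^ ν) f x - Gprev G f ν x) ∧
    LpNorm p (iteratedDeriv s (fun x => G (2 ^ ν) f x - Gprev G f ν x)) ≤
      K4 * 2 ^ (s * ν) * LpNorm p (fun x => G (2 ^ ν) f x - Gprev G f ν x)

noncomputable def Kfun (s : ℕ) (p : ℝ) (n : ℕ) (x : ℕ → ℝ) (f : ℝ → ℝ) : ℝ :=
  sInf {y | ∃ g : ℝ → ℝ, SobolevW s g ∧
    y = ellp p n x (fun t => f t - g t) + LpNorm p (fun t => f t - g t) +
        (1 / (n : ℝ) ^ s) * LpNorm p (iteratedDeriv s g)}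


noncomputable abbrev muT : Measure ℝ := volume.restrict (Set.Ioc (0:ℝ) 1)

lemma memLp_of_T {p : ℝ} (hp : 1 ≤ p) {f : ℝ → ℝ} (hf : MemLpT p f) :
    MemLp f (ENNReal.ofReal p) muT := by
  have h0 : ENNReal.ofReal p ≠ 0 := by simp; linarith
  rw [← integrable_norm_rpow_iff hf.2.1.aestronglyMeasurable h0 ENNReal.ofReal_ne_top,
    ENNReal.toReal_ofReal (by linarith)]
  have := hf.2.2
  rw [intervalIntegrable_iff_integrableOn_Ioc_of_le zero_le_one] at this
  exact this

lemma T_of_memLp {p : ℝ} (hp : 1 ≤ p) {f : ℝ → ℝ} (h1 : Function.Periodic f 1) (h2 : Measurable f)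
    (hf : MemLp f (ENNReal.ofReal p) muT) : MemLpT p f := by
  have h0 : ENNReal.ofReal p ≠ 0 := by simp; linarith
  refine ⟨h1, h2, ?_⟩
  rw [← integrable_norm_rpow_iff h2.aestronglyMeasurable h0 ENNReal.ofReal_ne_top,
    ENNReal.toReal_ofReal (by linarith)] at hf
  rw [intervalIntegrable_iff_integrableOn_Ioc_of_le zero_le_one]
  exact hf

lemma LpNorm_eq {p : ℝ} (hp : 1 ≤ p) {f : ℝ → ℝ} (hf : MemLp f (ENNReal.ofReal p) muT) :
    eLpNorm f (ENNReal.ofReal p) muT = ENNReal.ofReal (LpNorm p f) := by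
  have h0 : ENNReal.ofReal p ≠ 0 := by simp; linarith
  rw [hf.eLpNorm_eq_integral_rpow_norm h0 ENNReal.ofReal_ne_top,
    ENNReal.toReal_ofReal (by linarith), LpNorm, intervalIntegral.integral_of_le zero_le_one]
  simp

lemma LpNorm_nonneg (p : ℝ) (f : ℝ → ℝ) : 0 ≤ LpNorm p f := by
  apply Real.rpow_nonneg
  exact intervalIntegral.integral_nonneg zero_le_one fun x _ => Real.rpow_nonneg (abs_nonneg _) _

lemma LpNorm_le {p : ℝ} (hp : 1 ≤ p) {f : ℝ → ℝ} (hf : MemLp f (ENNReal.ofReal p) muT)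
    {C : ℝ} (hC : 0 ≤ C) (h : eLpNorm f (ENNReal.ofReal p) muT ≤ ENNReal.ofReal C) :
    LpNorm p f ≤ C := by
  rw [LpNorm_eq hp hf] at h
  exact (ENNReal.ofReal_le_ofReal_iff hC).1 h

lemma LpNorm_add {p : ℝ} (hp : 1 ≤ p) {f g : ℝ → ℝ} (hf : MemLpT p f) (hg : MemLpT p g) :
    LpNorm p (fun x => f x + g x) ≤ LpNorm p f + LpNorm p g := by
  have hf' := memLp_of_T hp hf
  have hg' := memLp_of_T hp hg
  refine LpNorm_le hp (hf'.add hg') (add_nonneg (LpNorm_nonneg _ _) (LpNorm_nonneg _ _)) ?_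
  refine (eLpNorm_add_le hf'.1 hg'.1 (by simpa using hp)).trans ?_
  rw [LpNorm_eq hp hf', LpNorm_eq hp hg', ENNReal.ofReal_add (LpNorm_nonneg _ _) (LpNorm_nonneg _ _)]

lemma T_add {p : ℝ} (hp : 1 ≤ p) {f g : ℝ → ℝ} (hf : MemLpT p f) (hg : MemLpT p g) :
    MemLpT p (fun x => f x + g x) :=
  T_of_memLp hp (hf.1.add hg.1) (hf.2.1.add hg.2.1) ((memLp_of_T hp hf).add (memLp_of_T hp hg))

lemma T_sub {p : ℝ} (hp : 1 ≤ p) {f g : ℝ → ℝ} (hf : MemLpT p f) (hg : MemLpT p g) :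
    MemLpT p (fun x => f x - g x) :=
  T_of_memLp hp (hf.1.sub hg.1) (hf.2.1.sub hg.2.1) ((memLp_of_T hp hf).sub (memLp_of_T hp hg))

lemma T_const_mul {p : ℝ} (hp : 1 ≤ p) {f : ℝ → ℝ} (hf : MemLpT p f) (c : ℝ) :
    MemLpT p (fun x => c * f x) :=
  T_of_memLp hp (fun x => by simp [hf.1 x]) (hf.2.1.const_mul c) ((memLp_of_T hp hf).const_mul c)

lemma T_sum {p : ℝ} (hp : 1 ≤ p) (φ : ℕ → ℝ → ℝ) (hφ : ∀ k, MemLpT p (φ k)) (c : ℕ → ℝ) (n : ℕ) :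
    MemLpT p (fun x => ∑ k ∈ Finset.range n, c k * φ k x) := by
  induction n with
  | zero =>
    have := T_const_mul hp (hφ 0) 0
    simpa using this
  | succ n ih =>
    simp only [Finset.sum_range_succ]
    exact T_add hp ih (T_const_mul hp (hφ n) _)

lemma T_shift {p : ℝ} {f : ℝ → ℝ} (hf : MemLpT p f) (h : ℝ) : MemLpT p (fun x => f (x + h)) := by
  refine ⟨hf.1.add_const h, hf.2.1.comp (measurable_id.add_const h), ?_⟩
  have hper : Function.Periodic (fun x => |f x| ^ p) 1 := fun x => by simp [hf.1 x]
  have h2 := hper.intervalIntegrable (t := 0) one_ne_zero (by simpa using hf.2.2) h (1 + h)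
  simpa using h2.comp_add_right h

lemma LpNorm_shift {p : ℝ} {f : ℝ → ℝ} (hf : MemLpT p f) (h : ℝ) :
    LpNorm p (fun x => f (x + h)) = LpNorm p f := by
  have hper : Function.Periodic (fun x => |f x| ^ p) 1 := fun x => by simp [hf.1 x]
  have h2 := hper.intervalIntegral_add_eq h 0
  unfold LpNorm
  rw [intervalIntegral.integral_comp_add_right (fun x => |f x| ^ p)]
  simp only [zero_add] at *
  rw [add_comm 1 h, h2]

lemma LpNorm_neg (p : ℝ) (f : ℝ → ℝ) : LpNorm p (fun x => - f x) = LpNorm p f := by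
  simp [LpNorm]

lemma T_intervalIntegrable {p : ℝ} (hp : 1 ≤ p) {f : ℝ → ℝ} (hf : MemLpT p f) (a b : ℝ) :
    IntervalIntegrable f volume a b := by
  refine hf.1.intervalIntegrable (t := 0) one_ne_zero ?_ a b
  rw [zero_add, intervalIntegrable_iff_integrableOn_Ioc_of_le zero_le_one]
  exact (memLp_of_T hp hf).integrable (by simpa using hp)

lemma Delta_one (h : ℝ) (f : ℝ → ℝ) : Delta 1 h f = fun x => f (x + h) - f x := by
  funext x; simp [Delta, Finset.sum_range_succ]; ring

lemma Delta_le_omega {p δ : ℝ} (hp : 1 ≤ p) {f : ℝ → ℝ} (hf : MemLpT p f) {h : ℝ} (h0 : 0 < h)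
    (hδ : h < δ) : LpNorm p (fun x => f (x + h) - f x) ≤ omegaMod 1 p f δ := by
  refine le_csSup ⟨2 * LpNorm p f, ?_⟩ ⟨h, h0, hδ, by rw [Delta_one]⟩
  rintro y ⟨h, _, _, rfl⟩
  rw [Delta_one]
  have := LpNorm_add hp (T_shift hf h) (T_const_mul hp hf (-1))
  simp only [neg_mul, one_mul, LpNorm_neg, LpNorm_shift hf, ← sub_eq_add_neg] at this
  linarith

lemma omega_nonneg (p δ : ℝ) (f : ℝ → ℝ) : 0 ≤ omegaMod 1 p f δ := by
  apply Real.sSup_nonneg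
  rintro y ⟨h, _, _, rfl⟩
  exact LpNorm_nonneg _ _

lemma diff_le_omega {p δ : ℝ} (hp : 1 ≤ p) {f : ℝ → ℝ} (hf : MemLpT p f) {h : ℝ} 
    (hδ : |h| < δ) : LpNorm p (fun x => f x - f (x + h)) ≤ omegaMod 1 p f δ := by
  rcases lt_trichotomy h 0 with h0 | h0 | h0
  · have h1 := Delta_le_omega (h := -h) hp hf (by linarith) (by rwa [abs_of_neg h0] at hδ)
    rw [← LpNorm_shift (T_sub hp (T_shift hf (-h)) hf) h] at h1
    simpa using h1
  · subst h0
    have : LpNorm p (fun x => f x - f (x + 0)) = 0 := by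
      simp [LpNorm, Real.zero_rpow (by linarith : p ≠ 0), Real.zero_rpow (inv_ne_zero (by linarith : p ≠ 0))]
    rw [this]; exact omega_nonneg _ _ _
  · have h1 := Delta_le_omega hp hf h0 (by rwa [abs_of_pos h0] at hδ)
    rw [← LpNorm_neg] at h1
    simpa using h1

lemma mink {p : ℝ} (hp : 1 ≤ p) (H : ℝ → ℝ → ℝ) (hH : Measurable (Function.uncurry H)) {C : ℝ}
    (hC : 0 ≤ C) (h : ∀ v ∈ Set.Ioc (-1/2 : ℝ) (1/2), MemLpT p (fun x => H x v) ∧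
      LpNorm p (fun x => H x v) ≤ C) :
    MemLp (fun x => ∫ v in (-1/2 : ℝ)..(1/2), H x v) (ENNReal.ofReal p) muT ∧
    LpNorm p (fun x => ∫ v in (-1/2 : ℝ)..(1/2), H x v) ≤ C := by
  have hp0 : 0 < p := by linarith
  have hm : StronglyMeasurable (fun x => ∫ v in (-1/2 : ℝ)..(1/2), H x v) := by
    simp_rw [intervalIntegral.integral_of_le (by norm_num : (-1/2 : ℝ) ≤ 1/2)]
    exact hH.stronglyMeasurable.integral_prod_right
  set ν : Measure ℝ := volume.restrict (Set.Ioc (-1/2 : ℝ) (1/2)) with hν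
  have hprob : IsProbabilityMeasure ν := ⟨by rw [hν]; simp; norm_num⟩
  have key : eLpNorm (fun x => ∫ v in (-1/2 : ℝ)..(1/2), H x v) (ENNReal.ofReal p) muT
      ≤ ENNReal.ofReal C := by
    rw [eLpNorm_eq_lintegral_rpow_enorm_toReal (by simpa using hp0) ENNReal.ofReal_ne_top,
      ENNReal.toReal_ofReal hp0.le, one_div p, ENNReal.rpow_inv_le_iff hp0]
    calc ∫⁻ x, ‖∫ v in (-1/2 : ℝ)..(1/2), H x v‖ₑ ^ p ∂muT
        ≤ ∫⁻ x, ∫⁻ v, ‖H x v‖ₑ ^ p ∂ν ∂muT := by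
          apply lintegral_mono
          intro x
          have hx : Measurable (H x) := hH.comp measurable_prodMk_left
          have h1 := eLpNorm'_le_eLpNorm'_of_exponent_le zero_lt_one hp ν hx.aestronglyMeasurable
          have h2 : ‖∫ v in (-1/2 : ℝ)..(1/2), H x v‖ₑ ≤ ∫⁻ v, ‖H x v‖ₑ ∂ν := by
            rw [intervalIntegral.integral_of_le (by norm_num : (-1/2 : ℝ) ≤ 1/2)]
            exact enorm_integral_le_lintegral_enorm _
          rw [eLpNorm'_eq_lintegral_enorm, eLpNorm'_eq_lintegral_enorm] at h1
          simp only [ENNReal.rpow_one, div_one, one_div] at h1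
          exact (ENNReal.le_rpow_inv_iff hp0).1 (h2.trans h1)
      _ = ∫⁻ v, ∫⁻ x, ‖H x v‖ₑ ^ p ∂muT ∂ν := by
          apply lintegral_lintegral_swap
          exact (hH.enorm.pow_const p).aemeasurable
      _ ≤ ∫⁻ v, ENNReal.ofReal C ^ p ∂ν := by
          apply setLIntegral_mono measurable_const
          intro v hv
          obtain ⟨h3, h4⟩ := h v hv
          have h5 := LpNorm_eq hp (memLp_of_T hp h3)
          have h6 := h5.le.trans (ENNReal.ofReal_le_ofReal h4)
          rwa [eLpNorm_eq_lintegral_rpow_enorm_toReal (by simpa using hp0) ENNReal.ofReal_ne_top,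
            ENNReal.toReal_ofReal hp0.le, one_div p, ENNReal.rpow_inv_le_iff hp0] at h6
      _ = ENNReal.ofReal C ^ p := by simp
  have hM : MemLp (fun x => ∫ v in (-1/2 : ℝ)..(1/2), H x v) (ENNReal.ofReal p) muT :=
    ⟨hm.aestronglyMeasurable, key.trans_lt ENNReal.ofReal_lt_top⟩
  exact ⟨hM, LpNorm_le hp hM hC key⟩

noncomputable def avgS (a : ℝ) (f : ℝ → ℝ) (x : ℝ) : ℝ := ∫ v in (-1/2 : ℝ)..(1/2), f (x + a * v)

lemma avgS_T {p : ℝ} (hp : 1 ≤ p) {f : ℝ → ℝ} (hf : MemLpT p f) (a : ℝ) :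
    MemLpT p (avgS a f) ∧ LpNorm p (avgS a f) ≤ LpNorm p f := by
  have hH : Measurable (Function.uncurry fun x v => f (x + a * v)) := by
    apply hf.2.1.comp
    fun_prop
  have h := mink hp (fun x v => f (x + a * v)) hH (LpNorm_nonneg p f)
    fun v _ => ⟨T_shift hf _, (LpNorm_shift hf _).le⟩
  refine ⟨T_of_memLp hp ?_ ?_ h.1, h.2⟩
  · intro x
    unfold avgS
    congr 1
    ext v
    rw [← hf.1 (x + a * v)]; congr 1; ring
  · have : StronglyMeasurable (avgS a f) := by
      unfold avgS
      simp_rw [intervalIntegral.integral_of_le (by norm_num : (-1/2 : ℝ) ≤ 1/2)]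
      exact hH.stronglyMeasurable.integral_prod_right
    exact this.measurable

lemma avgS_eq {f : ℝ → ℝ} (hf : ∀ a b, IntervalIntegrable f volume a b) (a x : ℝ) :
    a * avgS a f x = (∫ y in (0:ℝ)..(x + a / 2), f y) - ∫ y in (0:ℝ)..(x - a / 2), f y := by
  unfold avgS
  rw [intervalIntegral.mul_integral_comp_add_mul,
    intervalIntegral.integral_interval_sub_left (hf _ _) (hf _ _)]
  congr 1 <;> ring

lemma prim_cont {f : ℝ → ℝ} (hf : ∀ a b, IntervalIntegrable f volume a b) :
    Continuous (fun x => ∫ y in (0:ℝ)..x, f y) :=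
  intervalIntegral.continuous_primitive hf 0

lemma avgS_eq' {f : ℝ → ℝ} (hf : ∀ a b, IntervalIntegrable f volume a b) {a : ℝ} (ha : a ≠ 0) (x : ℝ) :
    avgS a f x = a⁻¹ * ((∫ y in (0:ℝ)..(x + a / 2), f y) - ∫ y in (0:ℝ)..(x - a / 2), f y) := by
  rw [← avgS_eq hf, inv_mul_cancel_left₀ ha]

lemma avgS_cont {f : ℝ → ℝ} (hf : ∀ a b, IntervalIntegrable f volume a b) {a : ℝ} (ha : a ≠ 0) :
    Continuous (avgS a f) := by
  have hF := prim_cont hf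
  rw [funext (avgS_eq' hf ha)]
  exact continuous_const.mul ((hF.comp (by fun_prop : Continuous fun x : ℝ => x + a / 2)).sub
    (hF.comp (by fun_prop : Continuous fun x : ℝ => x - a / 2)))

lemma avgS_deriv {A : ℝ → ℝ} (hA : Continuous A) {e : ℝ} (he : e ≠ 0) (x : ℝ) :
    HasDerivAt (avgS e A) (e⁻¹ * (A (x + e / 2) - A (x - e / 2))) x := by
  have hi : ∀ a b, IntervalIntegrable A volume a b := fun a b => hA.intervalIntegrable a b
  rw [funext (avgS_eq' hi he)]
  have h1 : ∀ y, HasDerivAt (fun x => ∫ y in (0:ℝ)..x, A y) (A y) y := fun y =>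
    intervalIntegral.integral_hasDerivAt_right (hi _ _)
      hA.stronglyMeasurable.stronglyMeasurableAtFilter hA.continuousAt
  exact (((h1 _).comp_add_const x (e / 2)).sub ((h1 _).comp_sub_const x (e / 2))).const_mul _

lemma avgS_avgS_deriv {f : ℝ → ℝ} (hf : ∀ a b, IntervalIntegrable f volume a b) {a e : ℝ}
    (ha : a ≠ 0) (he : e ≠ 0) :
    deriv (avgS e (avgS a f)) = fun x => a⁻¹ * (avgS e f (x + a / 2) - avgS e f (x + (- (a / 2)))) := by
  funext x
  rw [(avgS_deriv (avgS_cont hf ha) he x).deriv]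
  simp only [avgS_eq' hf ha, avgS_eq' hf he]
  rw [show x + e / 2 + a / 2 = x + a / 2 + e / 2 by ring,
    show x + e / 2 - a / 2 = x + -(a / 2) + e / 2 by ring,
    show x - e / 2 + a / 2 = x + a / 2 - e / 2 by ring,
    show x - e / 2 - a / 2 = x + -(a / 2) - e / 2 by ring]
  ring

lemma LpNorm_const_mul {p : ℝ} (hp : 1 ≤ p) (f : ℝ → ℝ) {c : ℝ} (hc : 0 ≤ c) :
    LpNorm p (fun x => c * f x) = c * LpNorm p f := by
  unfold LpNorm
  simp_rw [abs_mul, Real.mul_rpow (abs_nonneg _) (abs_nonneg _)]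
  rw [intervalIntegral.integral_const_mul, Real.mul_rpow (Real.rpow_nonneg (abs_nonneg _) _)
    (intervalIntegral.integral_nonneg zero_le_one fun x _ => Real.rpow_nonneg (abs_nonneg _) _),
    ← Real.rpow_mul (abs_nonneg _), mul_one_div_cancel (by linarith), Real.rpow_one, abs_of_nonneg hc]

lemma deriv_norm {p δ : ℝ} (hp : 1 ≤ p) {f : ℝ → ℝ} (hf : MemLpT p f) {a e : ℝ}
    (ha : 0 < a) (haδ : a < δ) (he : e ≠ 0) :
    LpNorm p (deriv (avgS e (avgS a f))) ≤ a⁻¹ * omegaMod 1 p f δ := by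
  have hi := T_intervalIntegrable hp hf
  rw [avgS_avgS_deriv hi ha.ne' he, LpNorm_const_mul hp _ (inv_nonneg.2 ha.le)]
  refine mul_le_mul_of_nonneg_left ?_ (inv_nonneg.2 ha.le)
  have hD : MemLpT p (fun x => f (x + a / 2) - f (x + -(a / 2))) :=
    T_sub hp (T_shift hf _) (T_shift hf _)
  have h1 : (fun x => avgS e f (x + a / 2) - avgS e f (x + (- (a / 2))))
      = avgS e (fun x => f (x + a / 2) - f (x + -(a / 2))) := by
    funext x
    have hh : ∀ c : ℝ, IntervalIntegrable (fun v => f (x + c + e * v)) volume (-1/2) (1/2) := by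
      intro c
      have h2 := ((T_intervalIntegrable hp (T_shift hf (x + c)) (e * (-1/2)) (e * (1/2))).comp_mul_left
        (c := e))
      simp only [mul_div_cancel_left₀ _ he] at h2
      simpa [add_comm, add_left_comm] using h2
    unfold avgS
    rw [← intervalIntegral.integral_sub (hh _) (hh _)]
    congr 1
    ext v
    congr 2 <;> ring
  rw [h1]
  refine (avgS_T hp hD e).2.trans ?_
  have h3 := Delta_le_omega hp hf ha haδ
  rw [← LpNorm_shift (T_sub hp (T_shift hf a) hf) (-(a / 2))] at h3
  have h5 : (fun x => f (x + a / 2) - f (x + -(a / 2)))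
      = fun x => f (x + -(a / 2) + a) - f (x + -(a / 2)) := by
    funext x
    rw [show x + -(a / 2) + a = x + a / 2 by ring]
  rw [h5]
  exact h3

lemma avgS_sub {p δ : ℝ} (hp : 1 ≤ p) {f : ℝ → ℝ} (hf : MemLpT p f) {a e : ℝ}
    (ha : 0 < a) (he : 0 < e) (hae : a + e ≤ δ) :
    LpNorm p (fun x => f x - avgS e (avgS a f) x) ≤ omegaMod 1 p f δ := by
  have hi := T_intervalIntegrable hp hf
  have key : ∀ g : ℝ → ℝ, MemLpT p g → ∀ b s : ℝ,
      (∀ v ∈ Set.Ioc (-1/2 : ℝ) (1/2), LpNorm p (fun x => f x - g (x + (s + b * v)))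
        ≤ omegaMod 1 p f δ) → b ≠ 0 →
      LpNorm p (fun x => f x - avgS b g (x + s)) ≤ omegaMod 1 p f δ := by
    intro g hg b s h hb
    have hmg := hg.2.1
    have hmf := hf.2.1
    have h2 := (mink hp (fun x v => f x - g (x + (s + b * v))) (by
      refine (hmf.comp measurable_fst).sub (hmg.comp ?_)
      fun_prop) (omega_nonneg p δ f)
      fun v hv => ⟨T_sub hp hf (T_shift hg _), h v hv⟩).2
    convert h2 using 2
    funext x
    have h3 := ((T_intervalIntegrable hp (T_shift hg (x + s)) (b * (-1/2)) (b * (1/2))).comp_mul_left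
        (c := b))
    simp only [mul_div_cancel_left₀ _ hb] at h3
    have h4 : IntervalIntegrable (fun v => g (x + (s + b * v))) volume (-1/2) (1/2) := by
      convert h3 using 3
      ring
    rw [intervalIntegral.integral_sub (by simp) h4]
    unfold avgS
    simp only [intervalIntegral.integral_const, smul_eq_mul]
    congr 1
    · norm_num
    · congr 1; ext v; congr 1; ring
  have h := key (avgS a f) (avgS_T hp hf a).1 e 0 ?_ he.ne'
  · simpa using h
  intro u hu
  refine key f hf a _ ?_ ha.ne'
  intro v hv
  refine diff_le_omega hp hf ?_
  rw [abs_lt]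
  constructor <;> nlinarith [hu.1, hu.2, hv.1, hv.2]

lemma steklov_one {δ : ℝ} (hδ : 0 < δ) (f : ℝ → ℝ) (x : ℝ) : steklov 1 δ f x = avgS δ f x := by
  have h1 : δ * avgS δ f x = ∫ t in (-(δ / 2))..(δ / 2), f (x + t) := by
    have := intervalIntegral.mul_integral_comp_mul_left (f := fun t => f (x + t)) (a := -1/2) (b := 1/2) δ
    unfold avgS
    rw [this]
    congr 1 <;> ring
  rw [eq_comm, ← mul_right_inj' hδ.ne', h1]
  simp [steklov]
  field_simp

lemma avg_tendsto {f : ℝ → ℝ} (hf : ∀ a b, IntervalIntegrable f volume a b) {δ : ℝ} (hδ : 0 < δ) (x : ℝ) :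
    Tendsto (fun e => avgS e (avgS (δ - e) f) x) (nhdsWithin 0 (Set.Ioi 0)) (nhds (avgS δ f x)) := by
  have hF := prim_cont hf
  set F := fun x => ∫ y in (0:ℝ)..x, f y with hFd
  have hc : Continuous (fun e : ℝ => ∫ v in (-1/2 : ℝ)..(1/2),
      (F (x + e * v + (δ - e) / 2) - F (x + e * v - (δ - e) / 2))) := by
    apply intervalIntegral.continuous_parametric_intervalIntegral_of_continuous'
    unfold Function.uncurry
    fun_prop
  have h2 : ContinuousAt (fun e : ℝ => (δ - e)⁻¹ * ∫ v in (-1/2 : ℝ)..(1/2),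
      (F (x + e * v + (δ - e) / 2) - F (x + e * v - (δ - e) / 2))) 0 := by
    refine ContinuousAt.mul (ContinuousAt.inv₀ (by fun_prop) (by simpa using hδ.ne')) hc.continuousAt
  have h3 := h2.tendsto
  have h4 : avgS δ f x = (δ - 0)⁻¹ * ∫ v in (-1/2 : ℝ)..(1/2),
      (F (x + 0 * v + (δ - 0) / 2) - F (x + 0 * v - (δ - 0) / 2)) := by
    rw [avgS_eq' hf hδ.ne']
    simp [hFd]
    norm_num
  rw [h4]
  refine (h3.mono_left nhdsWithin_le_nhds).congr' ?_
  have hlt : ∀ᶠ e in nhdsWithin (0:ℝ) (Set.Ioi 0), e < δ :=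
    nhdsWithin_le_nhds (eventually_lt_nhds hδ)
  filter_upwards [hlt] with e he
  rw [← intervalIntegral.integral_const_mul]
  unfold avgS
  congr 1
  ext v
  exact (avgS_eq' hf (sub_ne_zero.2 he.ne') _).symm

theorem stmt15 (p δ : ℝ) (n : ℕ) (X : ℕ → ℕ → ℝ) (φ : ℕ → ℕ → ℝ → ℝ)
    (G : ℕ → (ℝ → ℝ) → ℝ → ℝ)
    (hp : 1 ≤ p) (hδ : 0 < δ) (hn : 1 ≤ n)
    (hX : NodesOrd X) (hGform : SamplingForm p X φ G)
    (K1 : ℝ) (hK1 : 0 < K1) (hc1 : CondC1 p K1 X G) (K3 : ℝ) (hK3 : 0 < K3) (hc2' : CondC2' p K3 1 G)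
    (f : ℝ → ℝ) (hf : MemLpT p f) :
    LpNorm p (fun x => f x - G n f x) ≤
      K1 * ellp p n (X n) (fun x => steklov 1 δ f x - f x) +
        (1 + K3 / (δ * (n : ℝ))) * omegaMod 1 p f δ := by

  have hi := T_intervalIntegrable hp hf
  have hp0 : 0 < p := by linarith
  have hn0 : (0:ℝ) < n := by exact_mod_cast hn
  have hT : ∀ g : ℝ → ℝ, MemLpT p (G n g) := by
    intro g
    have : G n g = fun x => ∑ k ∈ Finset.range n, g (X n k) * φ n k x := funext (hGform.2 n g)
    rw [this]
    exact T_sum hp (φ n) (hGform.1 n) _ n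
  set W := omegaMod 1 p f δ with hW
  have main : ∀ e : ℝ, 0 < e → e < δ → LpNorm p (fun x => f x - G n f x) ≤
      K1 * ellp p n (X n) (fun x => avgS e (avgS (δ - e) f) x - f x) +
        (1 + K3 / ((δ - e) * (n : ℝ))) * W := by
    intro e he heδ
    have ha : 0 < δ - e := by linarith
    set g := avgS e (avgS (δ - e) f) with hg
    have hgT : MemLpT p g := (avgS_T hp (avgS_T hp hf _).1 e).1
    have hgS : SobolevW 1 g := by
      refine ⟨hgT.1, ?_⟩
      have : ContDiff ℝ 1 g := by
        rw [contDiff_one_iff_deriv]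
        refine ⟨fun x => (avgS_deriv (avgS_cont hi ha.ne') he.ne' x).differentiableAt, ?_⟩
        rw [hg, avgS_avgS_deriv hi ha.ne' he.ne']
        have := avgS_cont hi he.ne'
        fun_prop
      exact_mod_cast this
    have h1 : LpNorm p (fun x => f x - g x) ≤ W := avgS_sub hp hf ha he (by linarith)
    have h2 := hc2' g hgS n hn
    rw [iteratedDeriv_one, pow_one] at h2
    have h3 : LpNorm p (deriv g) ≤ (δ - e)⁻¹ * W := deriv_norm hp hf ha (by linarith) he.ne'
    have h4 := hc1 (fun x => g x - f x) (T_sub hp hgT hf) n hn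
    have h5 := LpNorm_add hp (T_sub hp hf hgT) (T_add hp (T_sub hp hgT (hT g)) (hT fun x => g x - f x))
    have h6 := LpNorm_add hp (T_sub hp hgT (hT g)) (hT fun x => g x - f x)
    have h7 : (fun x => f x - g x + (g x - G n g x + G n (fun x => g x - f x) x))
        = fun x => f x - G n f x := by
      funext x
      simp only [hGform.2, sub_mul, Finset.sum_sub_distrib]
      ring
    rw [h7] at h5
    have h8 : K3 / (n:ℝ) * LpNorm p (deriv g) ≤ K3 / (n:ℝ) * ((δ - e)⁻¹ * W) :=
      mul_le_mul_of_nonneg_left h3 (by positivity)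
    have h9 : (1 + K3 / ((δ - e) * (n : ℝ))) * W = W + K3 / (n:ℝ) * ((δ - e)⁻¹ * W) := by
      field_simp
    rw [h9]
    linarith
  have hst : (fun x => steklov 1 δ f x - f x) = fun x => avgS δ f x - f x := by
    funext x; rw [steklov_one hδ]
  rw [hst]
  have hlim1 : Tendsto (fun e => ellp p n (X n) (fun x => avgS e (avgS (δ - e) f) x - f x))
      (nhdsWithin 0 (Set.Ioi 0)) (nhds (ellp p n (X n) (fun x => avgS δ f x - f x))) := by
    unfold ellp
    refine Tendsto.rpow_const (Tendsto.const_mul _ (tendsto_finsetSum _ fun k _ => ?_))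
      (Or.inr (by positivity))
    exact Tendsto.rpow_const (((avg_tendsto hi hδ _).sub_const _).abs) (Or.inr hp0.le)
  have hlim2 : Tendsto (fun e : ℝ => (1 + K3 / ((δ - e) * (n : ℝ))) * W)
      (nhdsWithin 0 (Set.Ioi 0)) (nhds ((1 + K3 / (δ * (n : ℝ))) * W)) := by
    have hc : ContinuousAt (fun e : ℝ => (1 + K3 / ((δ - e) * (n : ℝ))) * W) 0 := by
      have : (δ - 0) * (n:ℝ) ≠ 0 := by rw [sub_zero]; positivity
      fun_prop (disch := assumption)
    have := hc.tendsto
    simp only [sub_zero] at this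
    exact this.mono_left nhdsWithin_le_nhds
  refine ge_of_tendsto ((hlim1.const_mul K1).add hlim2) ?_
  filter_upwards [self_mem_nhdsWithin, nhdsWithin_le_nhds (eventually_lt_nhds hδ)] with e he1 he2
  exact main e he1 he2
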